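/- Let F be a field and let f ∈ F[x_1,...,x_n] be a polynomial vanishing at every point of {0,1}^n. Then f lies in the ideal generated by x_1²−x_1, ..., x_n²−x_n. -/

import Mathlib

open MvPolynomial

/-- A polynomial vanishing at every point of `{0,1}ⁿ` lies in the ideal generated by the
polynomials `xᵢ²−xᵢ`. -/
theorem stmt13 {F : Type*} [Field F] (n : ℕ) (f : MvPolynomial (Fin n) F)
    (hvan : ∀ x : Fin n → F, (∀ i, x i = 0 ∨ x i = 1) → MvPolynomial.eval x f = 0) :
    f ∈ Ideal.span (Set.range fun i : Fin n => (X i : MvPolynomial (Fin n) F) ^ 2 - X i) := by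
  classical
  obtain ⟨h, -, hf⟩ := combinatorial_nullstellensatz_exists_linearCombination
    (fun _ : Fin n => ({0, 1} : Finset F)) (fun _ => ⟨0, by simp⟩) f
    (fun x hx => hvan x (fun i => by simpa using hx i))
  rw [hf, Finsupp.linearCombination_apply, Finsupp.sum]
  refine Ideal.sum_mem _ fun i _ => ?_
  rw [smul_eq_mul]
  refine Ideal.mul_mem_left _ _ ?_
  have e : (∏ r ∈ ({0, 1} : Finset F), ((X i : MvPolynomial (Fin n) F) - C r)) = X i ^ 2 - X i := by
    rw [Finset.prod_pair zero_ne_one, C_0, C_1]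
    ring
  rw [e]
  exact Ideal.subset_span ⟨i, rfl⟩
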